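/- Let I ⊆ ℝ be an interval and σ : I → ℝ a differentiable function with σ(e) > 0, σ'(e) < 0 for all e ∈ I, and σ' nondecreasing on I. Fix e₀ ∈ I and set d = −1 / (2 σ(e₀) σ'(e₀)) (so d > 0). Then for every constant c ∈ ℝ, the function u(e) = c − d·σ(e)² − e attains a strict global maximum on I at e = e₀; that is, u(e) < u(e₀) for every e ∈ I with e ≠ e₀. -/

import Mathlib

/-- The mean value theorem for a function differentiable within an order-connected set. -/
theorem exists_mem_Ioo_mul_sub_eq_of_hasDerivWithinAt {I : Set ℝ} (hI : I.OrdConnected)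
    {f f' : ℝ → ℝ} (hf : ∀ x ∈ I, HasDerivWithinAt f (f' x) I x) {a b : ℝ}
    (ha : a ∈ I) (hb : b ∈ I) (hab : a < b) :
    ∃ x ∈ Set.Ioo a b, f' x * (b - a) = f b - f a := by
  have hsub : Set.Icc a b ⊆ I := hI.out ha hb
  obtain ⟨x, hx, h⟩ := exists_hasDerivAt_eq_slope f f' hab
    (fun x hx => (hf x (hsub hx)).continuousWithinAt.mono hsub)
    (fun x hx => (hf x (hsub (Set.Ioo_subset_Icc_self hx))).hasDerivAt
      (Filter.mem_of_superset (Icc_mem_nhds hx.1 hx.2) hsub))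
  exact ⟨x, hx, by rw [h, div_mul_cancel₀ _ (sub_pos.2 hab).ne']⟩

/-- Let I ⊆ ℝ be an interval and σ : I → ℝ differentiable with σ > 0, σ' < 0 and σ'
nondecreasing on I. Fix e₀ ∈ I and set d = −1/(2 σ(e₀) σ'(e₀)) (so d > 0). Then for
every constant c, the function u(e) = c − d·σ(e)² − e attains a strict global maximum
on I at e = e₀. -/
theorem stmt_2 (I : Set ℝ) (hI : I.OrdConnected) (σ σ' : ℝ → ℝ)
    (hderiv : ∀ e ∈ I, HasDerivWithinAt σ (σ' e) I e)
    (hpos : ∀ e ∈ I, 0 < σ e)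
    (hneg : ∀ e ∈ I, σ' e < 0)
    (hmono : MonotoneOn σ' I)
    (e₀ : ℝ) (he₀ : e₀ ∈ I)
    (d : ℝ) (hd : d = -1 / (2 * σ e₀ * σ' e₀))
    (c : ℝ) :
    ∀ e ∈ I, e ≠ e₀ →
      c - d * σ e ^ 2 - e < c - d * σ e₀ ^ 2 - e₀ := by
  intro e he hne
  have hs₀ := hpos e₀ he₀
  have hp := hneg e₀ he₀
  obtain ⟨htangent, hσne⟩ : σ' e₀ * (e - e₀) ≤ σ e - σ e₀ ∧ σ e - σ e₀ ≠ 0 := by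
    rcases lt_or_gt_of_ne hne with hlt | hlt
    · obtain ⟨x, hx, h⟩ :=
        exists_mem_Ioo_mul_sub_eq_of_hasDerivWithinAt hI hderiv he he₀ hlt
      have hxI := hI.out he he₀ (Set.Ioo_subset_Icc_self hx)
      have hle := mul_le_mul_of_nonneg_right (hmono hxI he₀ hx.2.le) (sub_pos.2 hlt).le
      have hlt' := mul_neg_of_neg_of_pos (hneg x hxI) (sub_pos.2 hlt)
      exact ⟨by linarith, by linarith⟩
    · obtain ⟨x, hx, h⟩ :=
        exists_mem_Ioo_mul_sub_eq_of_hasDerivWithinAt hI hderiv he₀ he hlt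
      have hxI := hI.out he₀ he (Set.Ioo_subset_Icc_self hx)
      have hle := mul_le_mul_of_nonneg_right (hmono he₀ hxI hx.1.le) (sub_pos.2 hlt).le
      have hlt' := mul_neg_of_neg_of_pos (hneg x hxI) (sub_pos.2 hlt)
      exact ⟨by linarith, by linarith⟩
  have hden : 2 * σ e₀ * σ' e₀ < 0 := mul_neg_of_pos_of_neg (by positivity) hp
  have hdpos : 0 < d := hd ▸ div_pos_of_neg_of_neg (by norm_num) hden
  have hdmul : d * (2 * σ e₀ * σ' e₀) = -1 := by rw [hd, div_mul_cancel₀ _ hden.ne]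
  have hsq : 2 * σ e₀ * σ' e₀ * (e - e₀) < σ e ^ 2 - σ e₀ ^ 2 := by
    have h₁ := pow_pos (abs_pos.2 hσne) 2
    rw [sq_abs] at h₁
    have h₂ := mul_le_mul_of_nonneg_left htangent hs₀.le
    linarith
  have hmul := mul_lt_mul_of_pos_left hsq hdpos
  rw [← mul_assoc, hdmul] at hmul
  linarith
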